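/- arXiv:2502.18839 — 7 statements merged into one kernel-verified Lean document; each statement's English description precedes it below -/
import Mathlib

section
/- Let λ, β ∈ ℝ^{n_d} and γ ∈ ℝ^{n_s} be nonnegative, let 0 < ρ ≤ 1 with λ_i + ρ·β_i > 0 for every i, and let 0 ≤ α ≤ 1. Let x be a v-optimal solution for (λ + ρβ, γ), and define the average values v̄_i = (Σ_{j} v_{i,j} x_{i,j}) / (λ_i + ρβ_i) for each i. Then the proportional-cost global treatment effect is overestimated by the cost-excluded RCT estimator: (1−α)·Φ_v(λ+β, γ) − Φ_v(λ, γ) ≤ (1−α)·Σ_i v̄_i (λ_i + β_i) − Σ_i v̄_i λ_i. -/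
/-- A matrix `x` is CE-feasible for demand `d` and supply `s`. -/
def CEfeasible {nd ns : ℕ} (d : Fin nd → ℝ) (s : Fin ns → ℝ)
    (x : Fin nd → Fin ns → ℝ) : Prop :=
  (∀ i j, 0 ≤ x i j) ∧ (∀ i, ∑ j, x i j ≤ d i) ∧ (∀ j, ∑ i, x i j ≤ s j)

/-- The cost-excluded matching value `Φ_w(d,s)`. -/
noncomputable def Phi {nd ns : ℕ} (w : Fin nd → Fin ns → ℝ)
    (d : Fin nd → ℝ) (s : Fin ns → ℝ) : ℝ :=
  sSup {z : ℝ | ∃ x, CEfeasible d s x ∧ z = ∑ i, ∑ j, w i j * x i j}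

/-- `x` is a `w`-optimal solution for `(d,s)`. -/
def IsOptimal {nd ns : ℕ} (w : Fin nd → Fin ns → ℝ)
    (d : Fin nd → ℝ) (s : Fin ns → ℝ) (x : Fin nd → Fin ns → ℝ) : Prop :=
  CEfeasible d s x ∧ ∑ i, ∑ j, w i j * x i j = Phi w d s

/-- `(a,b)` is a `w`-optimal dual for `(d,s)`. -/
def IsOptimalDual {nd ns : ℕ} (w : Fin nd → Fin ns → ℝ)
    (d : Fin nd → ℝ) (s : Fin ns → ℝ) (a : Fin nd → ℝ) (b : Fin ns → ℝ) : Prop :=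
  (∀ i, 0 ≤ a i) ∧ (∀ j, 0 ≤ b j) ∧ (∀ i j, w i j ≤ a i + b j) ∧
  (∑ i, a i * d i) + (∑ j, b j * s j) = Phi w d s

theorem CEfeasible.zero {nd ns : ℕ} {d : Fin nd → ℝ} {s : Fin ns → ℝ}
    (hd : ∀ i, 0 ≤ d i) (hs : ∀ j, 0 ≤ s j) : CEfeasible d s (fun _ _ => 0) :=
  ⟨fun _ _ => le_rfl, fun i => by simpa using hd i, fun j => by simpa using hs j⟩

theorem CEfeasible.le_demand {nd ns : ℕ} {d : Fin nd → ℝ} {s : Fin ns → ℝ}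
    {x : Fin nd → Fin ns → ℝ} (hx : CEfeasible d s x) (i : Fin nd) (j : Fin ns) :
    x i j ≤ d i :=
  (Finset.single_le_sum (fun k _ => hx.1 i k) (Finset.mem_univ j)).trans (hx.2.1 i)

theorem CEfeasible.value_le_Phi {nd ns : ℕ} (w : Fin nd → Fin ns → ℝ)
    {d : Fin nd → ℝ} {s : Fin ns → ℝ} {x : Fin nd → Fin ns → ℝ} (hx : CEfeasible d s x) :
    ∑ i, ∑ j, w i j * x i j ≤ Phi w d s := by
  refine le_csSup ⟨∑ i, ∑ j, |w i j| * d i, ?_⟩ ⟨x, hx, rfl⟩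
  rintro z ⟨y, hy, rfl⟩
  refine Finset.sum_le_sum fun i _ => Finset.sum_le_sum fun j _ => ?_
  exact (mul_le_mul_of_nonneg_right (le_abs_self _) (hy.1 i j)).trans
    (mul_le_mul_of_nonneg_left (hy.le_demand i j) (abs_nonneg _))

theorem Phi_le {nd ns : ℕ} {w : Fin nd → Fin ns → ℝ} {d : Fin nd → ℝ} {s : Fin ns → ℝ}
    (hd : ∀ i, 0 ≤ d i) (hs : ∀ j, 0 ≤ s j) {c : ℝ}
    (h : ∀ x, CEfeasible d s x → ∑ i, ∑ j, w i j * x i j ≤ c) : Phi w d s ≤ c := by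
  refine csSup_le ⟨_, _, CEfeasible.zero hd hs, rfl⟩ ?_
  rintro z ⟨x, hx, rfl⟩
  exact h x hx

/-- Scaling each row of a feasible matrix down to a smaller demand keeps it feasible. -/
theorem CEfeasible.scale {nd ns : ℕ} {d d' : Fin nd → ℝ} {s : Fin ns → ℝ}
    {x : Fin nd → Fin ns → ℝ} (hx : CEfeasible d s x) (hd : ∀ i, 0 < d i)
    (hd' : ∀ i, 0 ≤ d' i) (hle : ∀ i, d' i ≤ d i) :
    CEfeasible d' s (fun i j => d' i / d i * x i j) := by
  have h0 : ∀ i, 0 ≤ d' i / d i := fun i => div_nonneg (hd' i) (hd i).le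
  refine ⟨fun i j => mul_nonneg (h0 i) (hx.1 i j), fun i => ?_, fun j => ?_⟩
  · rw [← Finset.mul_sum]
    exact (mul_le_mul_of_nonneg_left (hx.2.1 i) (h0 i)).trans
      (div_mul_cancel₀ _ (hd i).ne').le
  · refine (Finset.sum_le_sum fun i _ => ?_).trans (hx.2.2 j)
    exact mul_le_of_le_one_left (hx.1 i j) ((div_le_one (hd i)).2 (hle i))

theorem CEfeasible.combo {nd ns : ℕ} {d d' : Fin nd → ℝ} {s : Fin ns → ℝ}
    {x y : Fin nd → Fin ns → ℝ} (hx : CEfeasible d s x) (hy : CEfeasible d' s y)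
    {a b : ℝ} (ha : 0 ≤ a) (hb : 0 ≤ b) (hab : a + b = 1) :
    CEfeasible (fun i => a * d i + b * d' i) s (fun i j => a * x i j + b * y i j) := by
  refine ⟨fun i j => add_nonneg (mul_nonneg ha (hx.1 i j)) (mul_nonneg hb (hy.1 i j)),
    fun i => ?_, fun j => ?_⟩ <;>
    rw [Finset.sum_add_distrib, ← Finset.mul_sum, ← Finset.mul_sum]
  · exact add_le_add (mul_le_mul_of_nonneg_left (hx.2.1 i) ha)
      (mul_le_mul_of_nonneg_left (hy.2.1 i) hb)
  · calc _ ≤ a * s j + b * s j := add_le_add (mul_le_mul_of_nonneg_left (hx.2.2 j) ha)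
          (mul_le_mul_of_nonneg_left (hy.2.2 j) hb)
      _ = s j := by rw [← add_mul, hab, one_mul]

/-- the cost-excluded RCT estimator overestimates the
proportional-cost global treatment effect. -/
theorem rct_ce_overestimates_prop (nd ns : ℕ) (hnd : 0 < nd) (hns : 0 < ns)
    (v : Fin nd → Fin ns → ℝ)
    (lam beta : Fin nd → ℝ) (gam : Fin ns → ℝ)
    (hlam : ∀ i, 0 ≤ lam i) (hbeta : ∀ i, 0 ≤ beta i) (hgam : ∀ j, 0 ≤ gam j)
    (rho : ℝ) (hrho0 : 0 < rho) (hrho1 : rho ≤ 1)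
    (hpos : ∀ i, 0 < lam i + rho * beta i)
    (alpha : ℝ) (halpha0 : 0 ≤ alpha) (halpha1 : alpha ≤ 1)
    (x : Fin nd → Fin ns → ℝ)
    (hx : IsOptimal v (fun i => lam i + rho * beta i) gam x)
    (vbar : Fin nd → ℝ)
    (hvbar : ∀ i, vbar i = (∑ j, v i j * x i j) / (lam i + rho * beta i)) :
    (1 - alpha) * Phi v (fun i => lam i + beta i) gam - Phi v lam gam ≤
      (1 - alpha) * (∑ i, vbar i * (lam i + beta i)) - ∑ i, vbar i * lam i := by
  have hscale := hx.1.scale hpos hlam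
    fun i => le_add_of_nonneg_right (mul_nonneg hrho0.le (hbeta i))
  have hval : ∑ i, ∑ j, v i j * (lam i / (lam i + rho * beta i) * x i j) =
      ∑ i, vbar i * lam i := by
    refine Finset.sum_congr rfl fun i _ => ?_
    rw [hvbar, div_mul_eq_mul_div, mul_div_assoc, Finset.sum_mul]
    exact Finset.sum_congr rfl fun j _ => by ring
  have hopt : ∑ i, vbar i * (lam i + rho * beta i) =
      Phi v (fun i => lam i + rho * beta i) gam := by
    rw [← hx.2]
    exact Finset.sum_congr rfl fun i _ => by rw [hvbar, div_mul_cancel₀ _ (hpos i).ne']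
  have hlow : ∑ i, vbar i * lam i ≤ Phi v lam gam := hval ▸ hscale.value_le_Phi v
  have hhigh : Phi v (fun i => lam i + beta i) gam ≤ ∑ i, vbar i * (lam i + beta i) := by
    refine Phi_le (fun i => add_nonneg (hlam i) (hbeta i)) hgam fun y hy => ?_
    have hc := (hscale.combo hy (sub_nonneg.2 hrho1) hrho0.le (by ring)).value_le_Phi v
    have hd : (fun i => (1 - rho) * lam i + rho * (lam i + beta i)) =
        fun i => lam i + rho * beta i := by
      funext i; ring
    have hsplit : ∑ i, vbar i * (lam i + rho * beta i) =
        (1 - rho) * ∑ i, vbar i * lam i + rho * ∑ i, vbar i * (lam i + beta i) := by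
      rw [Finset.mul_sum, Finset.mul_sum, ← Finset.sum_add_distrib]
      exact Finset.sum_congr rfl fun i _ => by ring
    rw [hd, ← hopt, hsplit] at hc
    simp only [mul_add (v _ _), Finset.sum_add_distrib, mul_left_comm (v _ _) (1 - rho),
      mul_left_comm (v _ _) rho, ← Finset.mul_sum, hval] at hc
    exact le_of_mul_le_mul_left (le_of_add_le_add_left hc) hrho0
  have := mul_le_mul_of_nonneg_left hhigh (sub_nonneg.2 halpha1)
  linarith
end

section
/- Suppose v_{i,j} > 0 for all i,j, 0 < α < 1, v^tre = (1−α)v, and for each supply type j there is a demand type i(j) with v_{i(j),j} > v_{k,j} for every k ≠ i(j). Let λ, β ∈ ℝ^{n_d} and γ ∈ ℝ^{n_s} be nonnegative, let 0 < ρ < 1, and assume Σ_{j} γ_j < (1−ρ)·λ_i for every i. Then the pair (x^con, x^tre) with x^con_{i,j} = γ_j if i = i(j) and 0 otherwise, and x^tre = 0, is the unique optimal (value-attaining) CI-feasible solution for ((1−ρ)λ, ρ(λ+β), γ), and Φ_CI((1−ρ)λ, ρ(λ+β), γ) = Σ_j v_{i(j),j} γ_j. -/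
/-- A pair `(xcon, xtre)` is CI-feasible for `(dcon, dtre, s)`. -/
def CIfeasible {nd ns : ℕ} (dcon dtre : Fin nd → ℝ) (s : Fin ns → ℝ)
    (xcon xtre : Fin nd → Fin ns → ℝ) : Prop :=
  (∀ i j, 0 ≤ xcon i j) ∧ (∀ i j, 0 ≤ xtre i j) ∧
  (∀ i, ∑ j, xcon i j ≤ dcon i) ∧ (∀ i, ∑ j, xtre i j ≤ dtre i) ∧
  (∀ j, ∑ i, (xcon i j + xtre i j) ≤ s j)

/-- The cost-included matching value `Φ_CI(dcon, dtre, s)`. -/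
noncomputable def PhiCI {nd ns : ℕ} (v vtre : Fin nd → Fin ns → ℝ)
    (dcon dtre : Fin nd → ℝ) (s : Fin ns → ℝ) : ℝ :=
  sSup {z : ℝ | ∃ xcon xtre, CIfeasible dcon dtre s xcon xtre ∧
    z = ∑ i, ∑ j, (v i j * xcon i j + vtre i j * xtre i j)}

/-- `(xcon, xtre)` is an optimal CI-feasible solution for `(dcon, dtre, s)`. -/
def CIOptimal {nd ns : ℕ} (v vtre : Fin nd → Fin ns → ℝ)
    (dcon dtre : Fin nd → ℝ) (s : Fin ns → ℝ)
    (xcon xtre : Fin nd → Fin ns → ℝ) : Prop :=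
  CIfeasible dcon dtre s xcon xtre ∧
  ∑ i, ∑ j, (v i j * xcon i j + vtre i j * xtre i j) = PhiCI v vtre dcon dtre s

/-- `(acon, atre, b)` is an optimal CI dual for `(dcon, dtre, s)`. -/
def CIOptimalDual {nd ns : ℕ} (v vtre : Fin nd → Fin ns → ℝ)
    (dcon dtre : Fin nd → ℝ) (s : Fin ns → ℝ)
    (acon atre : Fin nd → ℝ) (b : Fin ns → ℝ) : Prop :=
  (∀ i, 0 ≤ acon i) ∧ (∀ i, 0 ≤ atre i) ∧ (∀ j, 0 ≤ b j) ∧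
  (∀ i j, v i j ≤ acon i + b j) ∧ (∀ i j, vtre i j ≤ atre i + b j) ∧
  (∑ i, acon i * dcon i) + (∑ i, atre i * dtre i) + (∑ j, b j * s j) =
    PhiCI v vtre dcon dtre s

/-- The shortfall of an allocation against the bound `∑ j, b j * s j` splits into the value of the
unused supply and the reduced costs of the matched pairs. -/
theorem dual_bound_sub_value {nd ns : ℕ} (v vtre xcon xtre : Fin nd → Fin ns → ℝ)
    (b s : Fin ns → ℝ) :
    ∑ j, b j * s j - ∑ i, ∑ j, (v i j * xcon i j + vtre i j * xtre i j) =
      ∑ j, (b j * (s j - ∑ i, (xcon i j + xtre i j)) +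
        ∑ i, ((b j - v i j) * xcon i j + (b j - vtre i j) * xtre i j)) := by
  rw [Finset.sum_comm, ← Finset.sum_sub_distrib]
  refine Finset.sum_congr rfl fun j _ => ?_
  rw [mul_sub, Finset.mul_sum, sub_add, ← Finset.sum_sub_distrib]
  congr 1
  exact Finset.sum_congr rfl fun i _ => by ring

/-- Weak duality with zero demand prices. -/
theorem CIfeasible.value_le {nd ns : ℕ} {v vtre xcon xtre : Fin nd → Fin ns → ℝ}
    {dcon dtre : Fin nd → ℝ} {s b : Fin ns → ℝ} (h : CIfeasible dcon dtre s xcon xtre)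
    (hb : ∀ j, 0 ≤ b j) (hv : ∀ i j, v i j ≤ b j) (hvtre : ∀ i j, vtre i j ≤ b j) :
    ∑ i, ∑ j, (v i j * xcon i j + vtre i j * xtre i j) ≤ ∑ j, b j * s j := by
  obtain ⟨hcon, htre, -, -, hs⟩ := h
  rw [← sub_nonneg, dual_bound_sub_value]
  exact Finset.sum_nonneg fun j _ => add_nonneg (mul_nonneg (hb j) (sub_nonneg.2 (hs j)))
    (Finset.sum_nonneg fun i _ => add_nonneg
      (mul_nonneg (sub_nonneg.2 (hv i j)) (hcon i j))
      (mul_nonneg (sub_nonneg.2 (hvtre i j)) (htre i j)))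

/-- Complementary slackness with zero demand prices. -/
theorem CIfeasible.slackness {nd ns : ℕ} {v vtre xcon xtre : Fin nd → Fin ns → ℝ}
    {dcon dtre : Fin nd → ℝ} {s b : Fin ns → ℝ} (h : CIfeasible dcon dtre s xcon xtre)
    (hb : ∀ j, 0 ≤ b j) (hv : ∀ i j, v i j ≤ b j) (hvtre : ∀ i j, vtre i j ≤ b j)
    (heq : ∑ i, ∑ j, (v i j * xcon i j + vtre i j * xtre i j) = ∑ j, b j * s j) (j : Fin ns) :
    b j * (s j - ∑ i, (xcon i j + xtre i j)) = 0 ∧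
      ∀ i, (b j - v i j) * xcon i j = 0 ∧ (b j - vtre i j) * xtre i j = 0 := by
  obtain ⟨hcon, htre, -, -, hs⟩ := h
  have hslack : ∀ j, 0 ≤ b j * (s j - ∑ i, (xcon i j + xtre i j)) := fun j =>
    mul_nonneg (hb j) (sub_nonneg.2 (hs j))
  have hc : ∀ i j, 0 ≤ (b j - v i j) * xcon i j := fun i j =>
    mul_nonneg (sub_nonneg.2 (hv i j)) (hcon i j)
  have ht : ∀ i j, 0 ≤ (b j - vtre i j) * xtre i j := fun i j =>
    mul_nonneg (sub_nonneg.2 (hvtre i j)) (htre i j)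
  have hct : ∀ j, 0 ≤ ∑ i, ((b j - v i j) * xcon i j + (b j - vtre i j) * xtre i j) := fun j =>
    Finset.sum_nonneg fun i _ => add_nonneg (hc i j) (ht i j)
  have hgap := dual_bound_sub_value v vtre xcon xtre b s
  rw [heq, sub_self, eq_comm,
    Finset.sum_eq_zero_iff_of_nonneg fun j _ => add_nonneg (hslack j) (hct j)] at hgap
  obtain ⟨h₁, h₂⟩ := (add_eq_zero_iff_of_nonneg (hslack j) (hct j)).1 (hgap j (Finset.mem_univ j))
  rw [Finset.sum_eq_zero_iff_of_nonneg fun i _ => add_nonneg (hc i j) (ht i j)] at h₂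
  exact ⟨h₁, fun i => (add_eq_zero_iff_of_nonneg (hc i j) (ht i j)).1 (h₂ i (Finset.mem_univ i))⟩

/-- in the low-supply regime with proportional cost, the matching
assigning each supply type fully to its strictly-best control demand type is the
unique optimal CI solution, and the value is `Σ_j v_{i(j),j} γ_j`. -/
theorem ci_low_supply_unique_optimum (nd ns : ℕ) (hnd : 0 < nd) (hns : 0 < ns)
    (v vtre : Fin nd → Fin ns → ℝ) (hv : ∀ i j, 0 < v i j)
    (alpha : ℝ) (halpha0 : 0 < alpha) (halpha1 : alpha < 1)
    (hvtre : ∀ i j, vtre i j = (1 - alpha) * v i j)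
    (ic : Fin ns → Fin nd)
    (hic : ∀ j, ∀ k, k ≠ ic j → v k j < v (ic j) j)
    (lam beta : Fin nd → ℝ) (gam : Fin ns → ℝ)
    (hlam : ∀ i, 0 ≤ lam i) (hbeta : ∀ i, 0 ≤ beta i) (hgam : ∀ j, 0 ≤ gam j)
    (rho : ℝ) (hrho0 : 0 < rho) (hrho1 : rho < 1)
    (hlow : ∀ i, ∑ j, gam j < (1 - rho) * lam i) :
    CIOptimal v vtre (fun i => (1 - rho) * lam i) (fun i => rho * (lam i + beta i)) gam
      (fun i j => if i = ic j then gam j else 0) (fun _ _ => 0) ∧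
    (∀ ycon ytre,
      CIOptimal v vtre (fun i => (1 - rho) * lam i) (fun i => rho * (lam i + beta i)) gam
        ycon ytre →
      ycon = (fun i j => if i = ic j then gam j else 0) ∧ ytre = (fun _ _ => 0)) ∧
    PhiCI v vtre (fun i => (1 - rho) * lam i) (fun i => rho * (lam i + beta i)) gam =
      ∑ j, v (ic j) j * gam j := by
  have hvle : ∀ i j, v i j ≤ v (ic j) j := fun i j => by
    by_cases h : i = ic j
    · rw [← h]
    · exact (hic j i h).le
  have hvtrelt : ∀ i j, vtre i j < v (ic j) j := fun i j => by
    rw [hvtre]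
    nlinarith [hvle i j, mul_pos halpha0 (hv i j)]
  have hfeas : CIfeasible (fun i => (1 - rho) * lam i) (fun i => rho * (lam i + beta i)) gam
      (fun i j => if i = ic j then gam j else 0) (fun _ _ => 0) := by
    refine ⟨fun i j => ?_, fun _ _ => le_rfl, fun i => ?_, fun i => ?_, fun j => by simp⟩
    · dsimp only
      split_ifs
      exacts [hgam j, le_rfl]
    · refine (Finset.sum_le_sum fun j _ => ?_).trans (hlow i).le
      dsimp only
      split_ifs
      exacts [le_rfl, hgam j]
    · simpa using mul_nonneg hrho0.le (add_nonneg (hlam i) (hbeta i))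
  have hval : ∑ i, ∑ j, (v i j * (if i = ic j then gam j else 0) + vtre i j * 0) =
      ∑ j, v (ic j) j * gam j := by
    rw [Finset.sum_comm]
    simp
  have hPhi : PhiCI v vtre (fun i => (1 - rho) * lam i) (fun i => rho * (lam i + beta i)) gam =
      ∑ j, v (ic j) j * gam j := by
    refine IsGreatest.csSup_eq ⟨⟨_, _, hfeas, hval.symm⟩, ?_⟩
    rintro _ ⟨xcon, xtre, hx, rfl⟩
    exact hx.value_le (fun j => (hv _ j).le) hvle fun i j => (hvtrelt i j).le
  refine ⟨⟨hfeas, hval.trans hPhi.symm⟩, ?_, hPhi⟩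
  rintro ycon ytre ⟨hy, hyval⟩
  have hslack := hy.slackness (fun j => (hv _ j).le) hvle (fun i j => (hvtrelt i j).le)
    (hyval.trans hPhi)
  have hytre : ∀ i j, ytre i j = 0 := fun i j =>
    (mul_eq_zero.1 ((hslack j).2 i).2).resolve_left (sub_pos.2 (hvtrelt i j)).ne'
  have hycon : ∀ i j, i ≠ ic j → ycon i j = 0 := fun i j h =>
    (mul_eq_zero.1 ((hslack j).2 i).1).resolve_left (sub_pos.2 (hic j i h)).ne'
  refine ⟨funext₂ fun i j => ?_, funext₂ hytre⟩
  split_ifs with h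
  · have hsum := (mul_eq_zero.1 (hslack j).1).resolve_left (hv _ j).ne'
    simp only [hytre, add_zero] at hsum
    rw [Finset.sum_eq_single_of_mem (ic j) (Finset.mem_univ _) fun i _ => hycon i j] at hsum
    rw [h]
    exact (sub_eq_zero.1 hsum).symm
  · exact hycon i j h
end

section
/- Let v, v^tre ∈ ℝ^{n_d×n_s}, and suppose for each demand type i there is a supply type j(i) such that v_{i,j(i)} > v_{i,j} and v^tre_{i,j(i)} > v^tre_{i,j} for all j ≠ j(i), and v^tre_{i,j(i)} > 0. Let λ, β ∈ ℝ^{n_d} and γ ∈ ℝ^{n_s} be nonnegative with λ_i > 0 for all i, and let 0 < ρ < 1. Assume: (H1) Σ_{i : j(i)=j} (λ_i + ρβ_i) ≤ γ_j for every j, so that the pair with x^con_{i,j} = (1−ρ)λ_i·[j = j(i)] and x^tre_{i,j} = ρ(λ_i+β_i)·[j = j(i)] is CI-feasible (and optimal) for ((1−ρ)λ, ρ(λ+β), γ); (H2) there is an index i* and an optimal CI-feasible solution (0, x*) for (0, λ+β, γ) such that for every i ≠ i*, x*_{i,j(i)} = λ_i + β_i and x*_{i,j} = 0 for j ≠ j(i),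 while x*_{i*,j(i*)} < λ_{i*} + β_{i*} and Σ_j x*_{i*,j} ≤ λ_{i*} + β_{i*}. Then the fluid cost-included RCT estimator computed from the solution in (H1), namely Δ̂ = Σ_i v^tre_{i,j(i)}(λ_i+β_i) − Σ_i v_{i,j(i)}λ_i, strictly overestimates the global treatment effect Δ = Φ_CI(0, λ+β, γ) − Φ_CI(λ, 0, γ): Δ̂ − Δ > 0. -/
/-- The values of CI-feasible pairs are bounded above. -/
theorem CIfeasible.bddAbove_values {nd ns : ℕ} (v vtre : Fin nd → Fin ns → ℝ)
    (dcon dtre : Fin nd → ℝ) (s : Fin ns → ℝ) :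
    BddAbove {z : ℝ | ∃ xcon xtre, CIfeasible dcon dtre s xcon xtre ∧
      z = ∑ i, ∑ j, (v i j * xcon i j + vtre i j * xtre i j)} := by
  refine ⟨∑ i, ∑ j, (|v i j| * dcon i + |vtre i j| * dtre i), ?_⟩
  rintro z ⟨xcon, xtre, ⟨hcon, htre, hdcon, hdtre, -⟩, rfl⟩
  refine Finset.sum_le_sum fun i _ => Finset.sum_le_sum fun j _ => ?_
  have hle_con : xcon i j ≤ dcon i :=
    (Finset.single_le_sum (fun k _ => hcon i k) (Finset.mem_univ j)).trans (hdcon i)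
  have hle_tre : xtre i j ≤ dtre i :=
    (Finset.single_le_sum (fun k _ => htre i k) (Finset.mem_univ j)).trans (hdtre i)
  exact add_le_add
    (mul_le_mul (le_abs_self _) hle_con (hcon i j) (abs_nonneg _))
    (mul_le_mul (le_abs_self _) hle_tre (htre i j) (abs_nonneg _))

/-- The value of a CI-feasible pair is at most the cost-included matching value. -/
theorem CIfeasible.value_le_PhiCI {nd ns : ℕ} {v vtre : Fin nd → Fin ns → ℝ}
    {dcon dtre : Fin nd → ℝ} {s : Fin ns → ℝ} {xcon xtre : Fin nd → Fin ns → ℝ}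
    (h : CIfeasible dcon dtre s xcon xtre) :
    ∑ i, ∑ j, (v i j * xcon i j + vtre i j * xtre i j) ≤ PhiCI v vtre dcon dtre s :=
  le_csSup (CIfeasible.bddAbove_values v vtre dcon dtre s) ⟨xcon, xtre, h, rfl⟩

/-- If all control demand fits onto the supply types `jc`, then matching it there gives a lower
bound for the cost-included matching value without treatment. -/
theorem sum_mul_le_PhiCI_control {nd ns : ℕ} (v vtre : Fin nd → Fin ns → ℝ)
    (jc : Fin nd → Fin ns) {d : Fin nd → ℝ} {s : Fin ns → ℝ} (hd : ∀ i, 0 ≤ d i)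
    (hs : ∀ j, ∑ i ∈ Finset.univ.filter (fun i => jc i = j), d i ≤ s j) :
    ∑ i, v i (jc i) * d i ≤ PhiCI v vtre d (fun _ => 0) s := by
  have hfeas : CIfeasible d (fun _ => 0) s
      (fun i j => if j = jc i then d i else 0) (fun _ _ => 0) := by
    refine ⟨fun i j => ?_, fun _ _ => le_rfl, fun i => by simp, fun i => by simp, fun j => ?_⟩
    · dsimp only
      split_ifs
      exacts [hd i, le_rfl]
    · simpa [Finset.sum_filter, eq_comm] using hs j
  simpa using hfeas.value_le_PhiCI (v := v) (vtre := vtre)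

/-- A weighted sum of a nonnegative allocation of total at most `d` is strictly below `w k * d`
when `k` is the unique best index, `w k` is positive and `k` receives less than `d`. -/
theorem sum_mul_lt_mul_of_lt_best {ι : Type*} [Fintype ι] {w x : ι → ℝ} {k : ι} {d : ℝ}
    (hw : ∀ j, j ≠ k → w j < w k) (hk : 0 < w k) (hx : ∀ j, 0 ≤ x j)
    (hxd : ∑ j, x j ≤ d) (hxk : x k < d) : ∑ j, w j * x j < w k * d := by
  have hle : ∀ j ∈ Finset.univ, w j * x j ≤ w k * x j := fun j _ => by
    rcases eq_or_ne j k with rfl | hj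
    · exact le_rfl
    · exact mul_le_mul_of_nonneg_right (hw j hj).le (hx j)
  rcases hxd.lt_or_eq with hlt | heq
  · calc ∑ j, w j * x j ≤ ∑ j, w k * x j := Finset.sum_le_sum hle
      _ = w k * ∑ j, x j := (Finset.mul_sum _ _ _).symm
      _ < w k * d := mul_lt_mul_of_pos_left hlt hk
  · obtain ⟨j, hjk, hj⟩ : ∃ j, j ≠ k ∧ 0 < x j := by
      by_contra! hzero
      have hsum : ∑ j, x j = x k :=
        Fintype.sum_eq_single k fun j hj => le_antisymm (hzero j hj) (hx j)
      linarith
    calc ∑ j, w j * x j < ∑ j, w k * x j :=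
          Finset.sum_lt_sum hle ⟨j, Finset.mem_univ j, mul_lt_mul_of_pos_right (hw j hjk) hj⟩
      _ = w k * d := by rw [← Finset.mul_sum, heq]

/-- at the supply level where one demand type can no longer be
fully matched to its best supply type in global treatment, the fluid
cost-included RCT estimator strictly overestimates the global treatment effect. -/
theorem rct_ci_positive_bias (nd ns : ℕ) (hnd : 0 < nd) (hns : 0 < ns)
    (v vtre : Fin nd → Fin ns → ℝ)
    (jc : Fin nd → Fin ns)
    (hjc : ∀ i, ∀ j, j ≠ jc i → v i j < v i (jc i))
    (hjctre : ∀ i, ∀ j, j ≠ jc i → vtre i j < vtre i (jc i))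
    (hjcpos : ∀ i, 0 < vtre i (jc i))
    (lam beta : Fin nd → ℝ) (gam : Fin ns → ℝ)
    (hlam : ∀ i, 0 < lam i) (hbeta : ∀ i, 0 ≤ beta i) (hgam : ∀ j, 0 ≤ gam j)
    (rho : ℝ) (hrho0 : 0 < rho) (hrho1 : rho < 1)
    -- (H1) enough supply at the experiment state
    (hH1 : ∀ j, ∑ i ∈ Finset.univ.filter (fun i => jc i = j),
      (lam i + rho * beta i) ≤ gam j)
    (hH1opt : CIOptimal v vtre (fun i => (1 - rho) * lam i)
      (fun i => rho * (lam i + beta i)) gam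
      (fun i j => if j = jc i then (1 - rho) * lam i else 0)
      (fun i j => if j = jc i then rho * (lam i + beta i) else 0))
    -- (H2) structure of an optimal solution in global treatment
    (istar : Fin nd) (xstar : Fin nd → Fin ns → ℝ)
    (hstaropt : CIOptimal v vtre (fun _ => 0) (fun i => lam i + beta i) gam
      (fun _ _ => 0) xstar)
    (hstar1 : ∀ i, i ≠ istar → xstar i (jc i) = lam i + beta i)
    (hstar2 : ∀ i, i ≠ istar → ∀ j, j ≠ jc i → xstar i j = 0)
    (hstar3 : xstar istar (jc istar) < lam istar + beta istar)
    (hstar4 : ∑ j, xstar istar j ≤ lam istar + beta istar)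
    (hatDelta Delta : ℝ)
    (hhat : hatDelta = (∑ i, vtre i (jc i) * (lam i + beta i))
      - ∑ i, v i (jc i) * lam i)
    (hDelta : Delta = PhiCI v vtre (fun _ => 0) (fun i => lam i + beta i) gam
      - PhiCI v vtre lam (fun _ => 0) gam) :
    0 < hatDelta - Delta := by
  have hcontrol : ∑ i, v i (jc i) * lam i ≤ PhiCI v vtre lam (fun _ => 0) gam := by
    refine sum_mul_le_PhiCI_control v vtre jc (fun i => (hlam i).le) fun j => ?_
    refine (Finset.sum_le_sum fun i _ => ?_).trans (hH1 j)
    exact le_add_of_nonneg_right (mul_nonneg hrho0.le (hbeta i))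
  have htreat : PhiCI v vtre (fun _ => 0) (fun i => lam i + beta i) gam
      < ∑ i, vtre i (jc i) * (lam i + beta i) := by
    have hnonneg : ∀ i j, 0 ≤ xstar i j := hstaropt.1.2.1
    have hrow : ∑ j, vtre istar j * xstar istar j
        < vtre istar (jc istar) * (lam istar + beta istar) :=
      sum_mul_lt_mul_of_lt_best (hjctre istar) (hjcpos istar) (hnonneg istar) hstar4 hstar3
    rw [← hstaropt.2]
    simp only [mul_zero, zero_add]
    refine Finset.sum_lt_sum (fun i _ => ?_) ⟨istar, Finset.mem_univ istar, hrow⟩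
    rcases eq_or_ne i istar with rfl | hi
    · exact hrow.le
    · rw [Fintype.sum_eq_single (jc i) fun j hj => by rw [hstar2 i hi j hj, mul_zero],
        hstar1 i hi]
  linarith
end

section
/- Suppose v_{i,j} > 0 for all i,j, and let d ∈ ℝ^{n_d}, s ∈ ℝ^{n_s} be nonnegative. If x is a v-optimal solution for (d,s), then the total matched mass equals the smaller of total demand and total supply: Σ_{i,j} x_{i,j} = min(Σ_i d_i, Σ_j s_j). -/
namespace CEfeasible

variable {nd ns : ℕ} {d : Fin nd → ℝ} {s : Fin ns → ℝ} {x : Fin nd → Fin ns → ℝ}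

theorem le_demand_s12 (hx : CEfeasible d s x) (i : Fin nd) (j : Fin ns) : x i j ≤ d i :=
  (Finset.single_le_sum (fun j _ => hx.1 i j) (Finset.mem_univ j)).trans (hx.2.1 i)

theorem value_le_Phi_s12 {w : Fin nd → Fin ns → ℝ} (hw : ∀ i j, 0 ≤ w i j)
    (hx : CEfeasible d s x) : ∑ i, ∑ j, w i j * x i j ≤ Phi w d s := by
  refine le_csSup ⟨∑ i, ∑ j, w i j * d i, ?_⟩ ⟨x, hx, rfl⟩
  rintro _ ⟨y, hy, rfl⟩
  exact Finset.sum_le_sum fun i _ => Finset.sum_le_sum fun j _ =>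
    mul_le_mul_of_nonneg_left (hy.le_demand_s12 i j) (hw i j)

/-- Mass that fits in the slack of row `i₀` and of column `j₀` may be added at `(i₀, j₀)`. -/
theorem add_entry (hx : CEfeasible d s x) {i₀ : Fin nd} {j₀ : Fin ns} {ε : ℝ} (hε : 0 ≤ ε)
    (hi : ∑ j, x i₀ j + ε ≤ d i₀) (hj : ∑ i, x i j₀ + ε ≤ s j₀) :
    CEfeasible d s fun i j => x i j + if i = i₀ then if j = j₀ then ε else 0 else 0 := by
  refine ⟨fun i j => ?_, fun i => ?_, fun j => ?_⟩
  · exact add_nonneg (hx.1 i j) (by split_ifs <;> simp [hε])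
  · by_cases h : i = i₀
    · subst h
      simpa [Finset.sum_add_distrib] using hi
    · simpa [h] using hx.2.1 i
  · by_cases h : j = j₀
    · subst h
      simpa [Finset.sum_add_distrib] using hj
    · simpa [h] using hx.2.2 j

end CEfeasible

/-- With positive weights, an optimal matching saturates every demand or every supply. -/
theorem IsOptimal.saturates {nd ns : ℕ} {v : Fin nd → Fin ns → ℝ} (hv : ∀ i j, 0 < v i j)
    {d : Fin nd → ℝ} {s : Fin ns → ℝ} {x : Fin nd → Fin ns → ℝ} (hx : IsOptimal v d s x) :
    (∀ i, ∑ j, x i j = d i) ∨ (∀ j, ∑ i, x i j = s j) := by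
  obtain ⟨hf, hopt⟩ := hx
  by_contra! h
  obtain ⟨⟨i₀, hi⟩, j₀, hj⟩ := h
  replace hi := lt_of_le_of_ne (hf.2.1 i₀) hi
  replace hj := lt_of_le_of_ne (hf.2.2 j₀) hj
  set ε := min (d i₀ - ∑ j, x i₀ j) (s j₀ - ∑ i, x i j₀)
  have hε : 0 < ε := lt_min (sub_pos.2 hi) (sub_pos.2 hj)
  have hεi : ε ≤ d i₀ - ∑ j, x i₀ j := min_le_left _ _
  have hεj : ε ≤ s j₀ - ∑ i, x i j₀ := min_le_right _ _
  have hle := (hf.add_entry hε.le (by linarith) (by linarith)).value_le_Phi_s12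
    fun i j => (hv i j).le
  simp only [mul_add, Finset.sum_add_distrib, mul_ite, mul_zero, Finset.sum_ite_irrel,
    Finset.sum_ite_eq', Finset.mem_univ, if_true, Finset.sum_const_zero, hopt] at hle
  linarith [mul_pos (hv i₀ j₀) hε]

/-- with positive weights, any optimal matching matches the
smaller of total demand and total supply. -/
theorem optimal_matching_mass (nd ns : ℕ) (hnd : 0 < nd) (hns : 0 < ns)
    (v : Fin nd → Fin ns → ℝ) (hv : ∀ i j, 0 < v i j)
    (d : Fin nd → ℝ) (s : Fin ns → ℝ)
    (hd : ∀ i, 0 ≤ d i) (hs : ∀ j, 0 ≤ s j)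
    (x : Fin nd → Fin ns → ℝ) (hx : IsOptimal v d s x) :
    ∑ i, ∑ j, x i j = min (∑ i, d i) (∑ j, s j) := by
  have hrow : ∑ i, ∑ j, x i j ≤ ∑ i, d i := Finset.sum_le_sum fun i _ => hx.1.2.1 i
  have hcol : ∑ i, ∑ j, x i j ≤ ∑ j, s j :=
    Finset.sum_comm.trans_le (Finset.sum_le_sum fun j _ => hx.1.2.2 j)
  rcases hx.saturates hv with h | h
  · have heq : ∑ i, ∑ j, x i j = ∑ i, d i := Finset.sum_congr rfl fun i _ => h i
    rw [min_eq_left (heq ▸ hcol), heq]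
  · have heq : ∑ i, ∑ j, x i j = ∑ j, s j :=
      Finset.sum_comm.trans (Finset.sum_congr rfl fun j _ => h j)
    rw [min_eq_right (heq ▸ hrow), heq]
end

section
/- Suppose v_{i,j} > 0 for all i,j, and let d ∈ ℝ^{n_d}, s ∈ ℝ^{n_s} be nonnegative with Σ_i d_i < Σ_j s_j. Then every v-optimal dual (A,B) for (d,s) satisfies A_i ≥ min_{i,j} v_{i,j} for every demand type i. -/
/-- If the total demand is less than the total supply, every optimal dual has a zero supply price. -/
theorem IsOptimalDual.exists_supply_price_eq_zero {nd ns : ℕ}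
    {v : Fin nd → Fin ns → ℝ} {d : Fin nd → ℝ} {s : Fin ns → ℝ}
    (hd : ∀ i, 0 ≤ d i) (hs : ∀ j, 0 ≤ s j) (hds : (∑ i, d i) < ∑ j, s j)
    {A : Fin nd → ℝ} {B : Fin ns → ℝ} (hAB : IsOptimalDual v d s A B) :
    ∃ j, B j = 0 := by
  obtain ⟨hA, hB, hv, hopt⟩ := hAB
  have hne : Nonempty (Fin ns) := by
    by_contra h
    rw [not_nonempty_iff] at h
    rw [Finset.univ_eq_empty (α := Fin ns), Finset.sum_empty] at hds
    exact hds.not_ge (Finset.sum_nonneg fun i _ => hd i)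
  obtain ⟨k, hk⟩ := Finite.exists_min B
  refine ⟨k, le_antisymm ?_ (hB k)⟩
  have hle : Phi v d s ≤
      (∑ i, A i * d i) + (∑ j, B j * s j) - B k * (∑ j, s j - ∑ i, d i) := by
    refine csSup_le ⟨_, 0, ⟨by simp, by simpa using hd, by simpa using hs⟩, rfl⟩ ?_
    rintro z ⟨x, ⟨hx, hxd, hxs⟩, rfl⟩
    have hval : ∑ i, ∑ j, v i j * x i j ≤
        (∑ i, A i * ∑ j, x i j) + ∑ j, B j * ∑ i, x i j := by
      calc ∑ i, ∑ j, v i j * x i j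
          ≤ ∑ i, ∑ j, (A i + B j) * x i j := by
            gcongr with i _ j _
            · exact hx i j
            · exact hv i j
        _ = _ := by
            simp only [add_mul, Finset.sum_add_distrib, Finset.mul_sum]
            congr 1
            exact Finset.sum_comm
    have hdemand : ∑ i, A i * ∑ j, x i j ≤ ∑ i, A i * d i :=
      Finset.sum_le_sum fun i _ => mul_le_mul_of_nonneg_left (hxd i) (hA i)
    have hsupply : B k * ∑ j, (s j - ∑ i, x i j) ≤ ∑ j, B j * (s j - ∑ i, x i j) := by
      rw [Finset.mul_sum]
      exact Finset.sum_le_sum fun j _ =>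
        mul_le_mul_of_nonneg_right (hk j) (sub_nonneg.2 (hxs j))
    have htotal : ∑ j, ∑ i, x i j ≤ ∑ i, d i := by
      rw [Finset.sum_comm]
      exact Finset.sum_le_sum fun i _ => hxd i
    have hslack := mul_le_mul_of_nonneg_left htotal (hB k)
    simp only [mul_sub, Finset.sum_sub_distrib] at hsupply ⊢
    linarith
  nlinarith

/-- in strict undersupply of demand, every optimal dual demand
price is at least the minimum matching value. -/
theorem demand_duals_lower_bound (nd ns : ℕ) (hnd : 0 < nd) (hns : 0 < ns)
    (v : Fin nd → Fin ns → ℝ) (hv : ∀ i j, 0 < v i j)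
    (vmin : ℝ) (hvminle : ∀ i j, vmin ≤ v i j) (hvminmem : ∃ i j, v i j = vmin)
    (d : Fin nd → ℝ) (s : Fin ns → ℝ)
    (hd : ∀ i, 0 ≤ d i) (hs : ∀ j, 0 ≤ s j)
    (hds : (∑ i, d i) < ∑ j, s j)
    (A : Fin nd → ℝ) (B : Fin ns → ℝ)
    (hAB : IsOptimalDual v d s A B) :
    ∀ i, vmin ≤ A i := by
  obtain ⟨j, hj⟩ := hAB.exists_supply_price_eq_zero hd hs hds
  intro i
  have h := hAB.2.2.1 i j
  rw [hj, add_zero] at h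
  exact (hvminle i j).trans h
end

section
/- Suppose v_{i,j} > 0 for all i,j, let 0 ≤ κ < min_{i,j} v_{i,j}, let v−κ denote the weight matrix with entries v_{i,j} − κ, let e denote the all-ones vector, and let d ∈ ℝ^{n_d}, s ∈ ℝ^{n_s} be nonnegative. If (A,B) is a v-optimal dual for (d,s), then: if Σ_i d_i < Σ_j s_j, the pair (A − κe, B) is a (v−κ)-optimal dual for (d,s); and if Σ_i d_i > Σ_j s_j, the pair (A, B − κe) is a (v−κ)-optimal dual for (d,s). -/
theorem CEfeasible.swap {nd ns : ℕ} {d : Fin nd → ℝ} {s : Fin ns → ℝ}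
    {x : Fin nd → Fin ns → ℝ} (h : CEfeasible d s x) :
    CEfeasible s d (fun j i => x i j) :=
  ⟨fun j i => h.1 i j, h.2.2, h.2.1⟩

theorem Phi_swap {nd ns : ℕ} (w : Fin nd → Fin ns → ℝ) (d : Fin nd → ℝ) (s : Fin ns → ℝ) :
    Phi (fun j i => w i j) s d = Phi w d s := by
  unfold Phi
  congr 1
  ext z
  constructor
  · rintro ⟨x, hx, rfl⟩
    exact ⟨_, hx.swap, Finset.sum_comm⟩
  · rintro ⟨x, hx, rfl⟩
    exact ⟨_, hx.swap, Finset.sum_comm⟩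

theorem IsOptimalDual.swap {nd ns : ℕ} {w : Fin nd → Fin ns → ℝ} {d : Fin nd → ℝ}
    {s : Fin ns → ℝ} {a : Fin nd → ℝ} {b : Fin ns → ℝ} (h : IsOptimalDual w d s a b) :
    IsOptimalDual (fun j i => w i j) s d b a := by
  obtain ⟨ha, hb, hw, he⟩ := h
  refine ⟨hb, ha, fun j i => ?_, ?_⟩
  · rw [add_comm]
    exact hw i j
  · rw [Phi_swap, add_comm]
    exact he

/-- The duality gap is the sum of the complementary slackness products. -/
theorem duality_gap_eq {nd ns : ℕ} (w x : Fin nd → Fin ns → ℝ) (d a : Fin nd → ℝ)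
    (s b : Fin ns → ℝ) :
    (∑ i, a i * d i) + (∑ j, b j * s j) - ∑ i, ∑ j, w i j * x i j =
      (∑ i, a i * (d i - ∑ j, x i j)) + (∑ j, b j * (s j - ∑ i, x i j)) +
        ∑ i, ∑ j, (a i + b j - w i j) * x i j := by
  have hcomm : ∑ j, ∑ i, b j * x i j = ∑ i, ∑ j, b j * x i j := Finset.sum_comm
  simp only [mul_sub, sub_mul, add_mul, Finset.sum_sub_distrib, Finset.sum_add_distrib,
    Finset.mul_sum, hcomm]
  ring

theorem weak_duality {nd ns : ℕ} {w x : Fin nd → Fin ns → ℝ} {d a : Fin nd → ℝ}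
    {s b : Fin ns → ℝ} (hx : CEfeasible d s x) (ha : ∀ i, 0 ≤ a i) (hb : ∀ j, 0 ≤ b j)
    (hw : ∀ i j, w i j ≤ a i + b j) :
    ∑ i, ∑ j, w i j * x i j ≤ (∑ i, a i * d i) + (∑ j, b j * s j) := by
  have h₁ : 0 ≤ ∑ i, a i * (d i - ∑ j, x i j) :=
    Finset.sum_nonneg fun i _ => mul_nonneg (ha i) (sub_nonneg.2 (hx.2.1 i))
  have h₂ : 0 ≤ ∑ j, b j * (s j - ∑ i, x i j) :=
    Finset.sum_nonneg fun j _ => mul_nonneg (hb j) (sub_nonneg.2 (hx.2.2 j))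
  have h₃ : 0 ≤ ∑ i, ∑ j, (a i + b j - w i j) * x i j :=
    Finset.sum_nonneg fun i _ => Finset.sum_nonneg fun j _ =>
      mul_nonneg (sub_nonneg.2 (hw i j)) (hx.1 i j)
  linarith [duality_gap_eq w x d a s b]

theorem isCompact_setOf_CEfeasible {nd ns : ℕ} (d : Fin nd → ℝ) (s : Fin ns → ℝ) :
    IsCompact {x | CEfeasible d s x} := by
  refine (isCompact_Icc (a := (0 : Fin nd → Fin ns → ℝ)) (b := fun i _ => d i)).of_isClosed_subset
    ?_ fun x hx => ⟨hx.1, fun i j => ?_⟩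
  · simp only [CEfeasible, Set.ofPred_and, Set.ofPred_forall]
    refine IsClosed.inter ?_ (IsClosed.inter ?_ ?_)
    · exact isClosed_iInter fun i => isClosed_iInter fun j =>
        isClosed_le (by fun_prop) (by fun_prop)
    · exact isClosed_iInter fun i => isClosed_le (by fun_prop) (by fun_prop)
    · exact isClosed_iInter fun j => isClosed_le (by fun_prop) (by fun_prop)
  · exact (Finset.single_le_sum (fun k _ => hx.1 i k) (Finset.mem_univ j)).trans (hx.2.1 i)

theorem exists_isOptimal {nd ns : ℕ} (w : Fin nd → Fin ns → ℝ) {d : Fin nd → ℝ}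
    {s : Fin ns → ℝ} (hd : ∀ i, 0 ≤ d i) (hs : ∀ j, 0 ≤ s j) : ∃ x, IsOptimal w d s x := by
  have hne : {x | CEfeasible d s x}.Nonempty :=
    ⟨0, fun _ _ => le_rfl, fun i => by simpa using hd i, fun j => by simpa using hs j⟩
  obtain ⟨x, hx, hmax⟩ := (isCompact_setOf_CEfeasible d s).exists_isMaxOn hne
    (f := fun x => ∑ i, ∑ j, w i j * x i j) (by fun_prop)
  refine ⟨x, hx, Eq.symm (IsGreatest.csSup_eq ?_)⟩
  refine ⟨⟨x, hx, rfl⟩, ?_⟩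
  rintro z ⟨y, hy, rfl⟩
  exact hmax hy

theorem isOptimalDual_of_eq {nd ns : ℕ} {w x : Fin nd → Fin ns → ℝ} {d a : Fin nd → ℝ}
    {s b : Fin ns → ℝ} (hx : CEfeasible d s x) (ha : ∀ i, 0 ≤ a i) (hb : ∀ j, 0 ≤ b j)
    (hw : ∀ i j, w i j ≤ a i + b j)
    (he : (∑ i, a i * d i) + (∑ j, b j * s j) = ∑ i, ∑ j, w i j * x i j) :
    IsOptimalDual w d s a b := by
  refine ⟨ha, hb, hw, Eq.symm (IsGreatest.csSup_eq ?_)⟩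
  refine ⟨⟨x, hx, he⟩, ?_⟩
  rintro z ⟨y, hy, rfl⟩
  exact weak_duality hy ha hb hw

theorem complementary_slackness {nd ns : ℕ} {w x : Fin nd → Fin ns → ℝ} {d a : Fin nd → ℝ}
    {s b : Fin ns → ℝ} (hx : IsOptimal w d s x) (hab : IsOptimalDual w d s a b) :
    (∀ i, a i * (d i - ∑ j, x i j) = 0) ∧ ∀ j, b j * (s j - ∑ i, x i j) = 0 := by
  obtain ⟨hx, hxe⟩ := hx
  obtain ⟨ha, hb, hw, he⟩ := hab
  have n₁ : ∀ i ∈ Finset.univ, 0 ≤ a i * (d i - ∑ j, x i j) :=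
    fun i _ => mul_nonneg (ha i) (sub_nonneg.2 (hx.2.1 i))
  have n₂ : ∀ j ∈ Finset.univ, 0 ≤ b j * (s j - ∑ i, x i j) :=
    fun j _ => mul_nonneg (hb j) (sub_nonneg.2 (hx.2.2 j))
  have h₁ := Finset.sum_nonneg n₁
  have h₂ := Finset.sum_nonneg n₂
  have h₃ : 0 ≤ ∑ i, ∑ j, (a i + b j - w i j) * x i j :=
    Finset.sum_nonneg fun i _ => Finset.sum_nonneg fun j _ =>
      mul_nonneg (sub_nonneg.2 (hw i j)) (hx.1 i j)
  have gap := duality_gap_eq w x d a s b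
  have z₁ : ∑ i, a i * (d i - ∑ j, x i j) = 0 := by linarith
  have z₂ : ∑ j, b j * (s j - ∑ i, x i j) = 0 := by linarith
  exact ⟨fun i => (Finset.sum_eq_zero_iff_of_nonneg n₁).1 z₁ i (Finset.mem_univ i),
    fun j => (Finset.sum_eq_zero_iff_of_nonneg n₂).1 z₂ j (Finset.mem_univ j)⟩

/-- When demand is scarce, discounting all weights by `kappa` lowers the demand duals
by `kappa`. -/
theorem IsOptimalDual.sub_const_of_sum_lt {nd ns : ℕ} {v : Fin nd → Fin ns → ℝ} {kappa : ℝ}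
    (hkappa0 : 0 ≤ kappa) (hkappa : ∀ i j, kappa < v i j) {d : Fin nd → ℝ} {s : Fin ns → ℝ}
    (hd : ∀ i, 0 ≤ d i) (hs : ∀ j, 0 ≤ s j) {A : Fin nd → ℝ} {B : Fin ns → ℝ}
    (hAB : IsOptimalDual v d s A B) (hlt : (∑ i, d i) < ∑ j, s j) :
    IsOptimalDual (fun i j => v i j - kappa) d s (fun i => A i - kappa) B := by
  obtain ⟨x, hx⟩ := exists_isOptimal v hd hs
  obtain ⟨slackA, slackB⟩ := complementary_slackness hx hAB
  obtain ⟨hx, hxe⟩ := hx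
  obtain ⟨-, hB, hw, he⟩ := hAB
  have hsum : ∑ j, ∑ i, x i j < ∑ j, s j := by
    rw [Finset.sum_comm]
    exact (Finset.sum_le_sum fun i _ => hx.2.1 i).trans_lt hlt
  obtain ⟨j₀, -, hj₀⟩ := Finset.exists_lt_of_sum_lt hsum
  have hB₀ : B j₀ = 0 := (mul_eq_zero.1 (slackB j₀)).resolve_right (sub_pos.2 hj₀).ne'
  have hA : ∀ i, kappa < A i := fun i => by linarith [hkappa i j₀, hw i j₀]
  have hrow : ∀ i, d i = ∑ j, x i j := fun i =>
    sub_eq_zero.1 ((mul_eq_zero.1 (slackA i)).resolve_left (hkappa0.trans_lt (hA i)).ne')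
  refine isOptimalDual_of_eq hx (fun i => (sub_pos.2 (hA i)).le) hB
    (fun i j => by linarith [hw i j]) ?_
  have hdx : ∑ i, kappa * d i = ∑ i, ∑ j, kappa * x i j := by
    simp only [hrow, Finset.mul_sum]
  simp only [sub_mul, Finset.sum_sub_distrib]
  linarith

/-- discounted shadow prices can be obtained by shifting either
the demand or the supply duals by `κ`, depending on which side is scarce. -/
theorem discounted_shadow_prices (nd ns : ℕ) (hnd : 0 < nd) (hns : 0 < ns)
    (v : Fin nd → Fin ns → ℝ) (hv : ∀ i j, 0 < v i j)
    (kappa : ℝ) (hkappa0 : 0 ≤ kappa) (hkappa : ∀ i j, kappa < v i j)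
    (d : Fin nd → ℝ) (s : Fin ns → ℝ)
    (hd : ∀ i, 0 ≤ d i) (hs : ∀ j, 0 ≤ s j)
    (A : Fin nd → ℝ) (B : Fin ns → ℝ)
    (hAB : IsOptimalDual v d s A B) :
    ((∑ i, d i) < ∑ j, s j →
      IsOptimalDual (fun i j => v i j - kappa) d s (fun i => A i - kappa) B) ∧
    ((∑ j, s j) < ∑ i, d i →
      IsOptimalDual (fun i j => v i j - kappa) d s A (fun j => B j - kappa)) := by
  exact ⟨hAB.sub_const_of_sum_lt hkappa0 hkappa hd hs, fun hlt =>
    (hAB.swap.sub_const_of_sum_lt hkappa0 (fun j i => hkappa i j) hs hd hlt).swap⟩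
end

section
/- Let A be a real m×n matrix, c ∈ ℝ^n, and let D = { p ∈ ℝ^m : Aᵀp ≤ c }. Let b₁, b₂ ∈ ℝ^m, and for each t ∈ [0,1] set b_t = (1−t)·b₁ + t·b₂ and F(b_t) = sup { p·b_t : p ∈ D }. Suppose that for every t ∈ [0,1] this supremum is finite and attained by some element of D, that F is affine on the segment, i.e. F(b_t) = (1−t)·F(b₁) + t·F(b₂) for all t ∈ [0,1], and that p₁ is the unique maximizer of p ↦ p·b₁ over D and p₂ is the unique maximizer of p ↦ p·b₂ over D. Then p₁ = p₂. -/
/-- LP sensitivity. If the optimal value of the dual LP is affine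
along the segment from `b₁` to `b₂` (finite and attained throughout), and the
maximizers at the endpoints are unique, then they coincide. -/
theorem lp_sensitivity_unique_dual (m n : ℕ)
    (A : Matrix (Fin m) (Fin n) ℝ) (c : Fin n → ℝ)
    (D : Set (Fin m → ℝ))
    (hD : D = {p : Fin m → ℝ | ∀ j, (∑ i, A i j * p i) ≤ c j})
    (b1 b2 : Fin m → ℝ) (F : ℝ → ℝ)
    -- for each `t ∈ [0,1]`, the supremum of `p ↦ p · b_t` over `D` is finite
    -- and attained, with value `F t`
    (hFattained : ∀ t ∈ Set.Icc (0:ℝ) 1, ∃ p ∈ D,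
      (∑ i, p i * ((1 - t) * b1 i + t * b2 i)) = F t ∧
      ∀ q ∈ D, (∑ i, q i * ((1 - t) * b1 i + t * b2 i)) ≤ F t)
    -- `F` is affine on the segment
    (haffine : ∀ t ∈ Set.Icc (0:ℝ) 1, F t = (1 - t) * F 0 + t * F 1)
    (p1 p2 : Fin m → ℝ) (hp1 : p1 ∈ D) (hp2 : p2 ∈ D)
    -- `p1` is the unique maximizer of `p ↦ p · b₁` over `D`
    (hp1max : ∀ q ∈ D, (∑ i, q i * b1 i) ≤ ∑ i, p1 i * b1 i)
    (hp1uniq : ∀ q ∈ D, (∑ i, q i * b1 i) = (∑ i, p1 i * b1 i) → q = p1)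
    -- `p2` is the unique maximizer of `p ↦ p · b₂` over `D`
    (hp2max : ∀ q ∈ D, (∑ i, q i * b2 i) ≤ ∑ i, p2 i * b2 i)
    (hp2uniq : ∀ q ∈ D, (∑ i, q i * b2 i) = (∑ i, p2 i * b2 i) → q = p2) :
    p1 = p2 := by
  obtain ⟨p, hp, hpF, -⟩ := hFattained (1 / 2) (by norm_num)
  obtain ⟨-, -, -, h0⟩ := hFattained 0 (by norm_num)
  obtain ⟨-, -, -, h1⟩ := hFattained 1 (by norm_num)
  have hF0 := h0 p1 hp1
  have hF1 := h1 p2 hp2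
  simp only [sub_zero, one_mul, zero_mul, add_zero] at hF0
  simp only [sub_self, one_mul, zero_mul, zero_add] at hF1
  have hsplit : ∑ i, p i * ((1 - 1 / 2) * b1 i + 1 / 2 * b2 i) =
      1 / 2 * ∑ i, p i * b1 i + 1 / 2 * ∑ i, p i * b2 i := by
    rw [Finset.mul_sum, Finset.mul_sum, ← Finset.sum_add_distrib]
    exact Finset.sum_congr rfl fun i _ => by ring
  have hmid := haffine (1 / 2) (by norm_num)
  have hle1 := hp1max p hp
  have hle2 := hp2max p hp
  exact (hp1uniq p hp (by linarith)).symm.trans (hp2uniq p hp (by linarith))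
end
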